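/- arXiv:0803.1313 — 2 statements merged into one kernel-verified Lean document; each statement's English description precedes it below -/
import Mathlib

section
/- For every n ≥ 1 and λ > 0, the following integral identity over the open disk D := {z ∈ ℝ^{2n} : |z| < 1/λ} holds: ∫_D |z|·(1−λ²|z|²)^{−1/2} dz = 2nλ·∫_D f_λ(|z|) dz + ∫_D |z|·(1−λ²|z|²)^{1/2} dz. (Geometrically: the sub-Riemannian area of the upper hemisphere of the Pansu sphere S_λ equals 2nλ times the volume of the upper half-ball B_λ ∩ {t > 0} plus the flux of the calibration field through the equatorial disk; this is the divergence-theorem identity applied to B_λ ∩ {t > 0}.) -/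
open MeasureTheory Real Filter Set
open scoped BigOperators ENNReal NNReal Topology

noncomputable section

/-- The Heisenberg group `ℍⁿ` modeled as `ℝⁿ × ℝⁿ × ℝ`, coordinates `(x, y, t)`. -/
abbrev Hei (n : ℕ) : Type := (Fin n → ℝ) × (Fin n → ℝ) × ℝ

/-- Euclidean norm of the horizontal component `z = (x,y)` of a point. -/
def zNorm {n : ℕ} (p : Hei n) : ℝ := Real.sqrt (∑ i, ((p.1 i) ^ 2 + (p.2.1 i) ^ 2))

/-- Derivative along the left-invariant frame field `Xᵢ = ∂/∂xᵢ + yᵢ ∂/∂t`. -/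
def Xder {n : ℕ} (F : Hei n → ℝ) (i : Fin n) (p : Hei n) : ℝ :=
  fderiv ℝ F p (Pi.single i 1, 0, 0) + p.2.1 i * fderiv ℝ F p (0, 0, 1)

/-- Derivative along the left-invariant frame field `Yᵢ = ∂/∂yᵢ − xᵢ ∂/∂t`. -/
def Yder {n : ℕ} (F : Hei n → ℝ) (i : Fin n) (p : Hei n) : ℝ :=
  fderiv ℝ F p (0, Pi.single i 1, 0) - p.1 i * fderiv ℝ F p (0, 0, 1)

/-- Horizontal divergence of the horizontal field with frame coefficients `(a, b)`. -/
def hDivergence {n : ℕ} (a b : Hei n → Fin n → ℝ) (p : Hei n) : ℝ :=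
  ∑ i, (Xder (fun q => a q i) i p + Yder (fun q => b q i) i p)

/-- Admissible test fields for the horizontal perimeter in an open set `Ω`:
`C¹` with compact support in `Ω` and pointwise length at most `1`. -/
def IsAdmissible {n : ℕ} (Ω : Set (Hei n)) (a b : Hei n → Fin n → ℝ) : Prop :=
  ContDiff ℝ 1 a ∧ ContDiff ℝ 1 b ∧ HasCompactSupport a ∧ HasCompactSupport b ∧
  tsupport a ⊆ Ω ∧ tsupport b ⊆ Ω ∧ ∀ p, ∑ i, ((a p i) ^ 2 + (b p i) ^ 2) ≤ 1

/-- Horizontal (sub-Riemannian) perimeter of `E` relative to the open set `Ω`. -/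
def hPerimeter {n : ℕ} (E Ω : Set (Hei n)) : ℝ≥0∞ :=
  ⨆ ab : {ab : (Hei n → Fin n → ℝ) × (Hei n → Fin n → ℝ) // IsAdmissible Ω ab.1 ab.2},
    ENNReal.ofReal (∫ p in E, hDivergence ab.1.1 ab.1.2 p)

/-- Profile function `f_λ` of the Pansu sphere. -/
def pansuProfile (lam ρ : ℝ) : ℝ :=
  (1 / (2 * lam ^ 2)) * (lam * ρ * Real.sqrt (1 - lam ^ 2 * ρ ^ 2) + Real.arccos (lam * ρ))

/-- The Pansu ball `B_λ`. -/
def pansuBall (n : ℕ) (lam : ℝ) : Set (Hei n) :=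
  {p | zNorm p ≤ 1 / lam ∧ |p.2.2| ≤ pansuProfile lam (zNorm p)}

/-- The Pansu sphere `S_λ = ∂B_λ`. -/
def pansuSphere (n : ℕ) (lam : ℝ) : Set (Hei n) :=
  {p | zNorm p ≤ 1 / lam ∧
    (p.2.2 = pansuProfile lam (zNorm p) ∨ p.2.2 = -pansuProfile lam (zNorm p))}

/-- The closed vertical cylinder `C_r` over the disk of radius `r`. -/
def cylinder (n : ℕ) (r : ℝ) : Set (Hei n) := {p | zNorm p ≤ r}

/-- The closed horizontal disk `D_r` in the hyperplane `{t = 0}`. -/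
def disk (n : ℕ) (r : ℝ) : Set (Hei n) := {p | zNorm p ≤ r ∧ p.2.2 = 0}

/-- `p` is a point of Lebesgue density one of `E`. -/
def DensityOnePoint {n : ℕ} (E : Set (Hei n)) (p : Hei n) : Prop :=
  Tendsto (fun ρ => volume (E ∩ Metric.closedBall p ρ) / volume (Metric.closedBall p ρ))
    (nhdsWithin 0 (Set.Ioi 0)) (nhds 1)

/-- Euclidean norm on `ℝ^{2n} = ℝⁿ × ℝⁿ`, the space of horizontal coordinates `z`. -/
def zNorm2 {n : ℕ} (z : (Fin n → ℝ) × (Fin n → ℝ)) : ℝ :=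
  Real.sqrt (∑ i, ((z.1 i) ^ 2 + (z.2 i) ^ 2))

lemma aux_radial (n : ℕ) (hn : 1 ≤ n) (R : ℝ) (g : ℝ → ℝ) :
    (∫ z in {z : (Fin n → ℝ) × (Fin n → ℝ) | zNorm2 z < R}, g (zNorm2 z))
      = ((2 * n : ℕ) • (volume : Measure (EuclideanSpace ℝ (Fin n ⊕ Fin n))).real
          (Metric.ball 0 1)) * ∫ y in Ioo 0 R, y ^ (2 * n - 1) * g y := by
  haveI : Nonempty (Fin n) := ⟨⟨0, hn⟩⟩
  let e : EuclideanSpace ℝ (Fin n ⊕ Fin n) ≃ᵐ (Fin n → ℝ) × (Fin n → ℝ) :=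
    (MeasurableEquiv.toLp 2 (Fin n ⊕ Fin n → ℝ)).symm.trans
      (MeasurableEquiv.sumPiEquivProdPi (fun _ : Fin n ⊕ Fin n => ℝ))
  have he : MeasurePreserving e volume volume :=
    (EuclideanSpace.volume_preserving_symm_measurableEquiv_toLp (Fin n ⊕ Fin n)).trans
      (volume_measurePreserving_sumPiEquivProdPi (fun _ : Fin n ⊕ Fin n => ℝ))
  have hnorm : ∀ x, zNorm2 (e x) = ‖x‖ := by
    intro x
    rw [EuclideanSpace.norm_eq]
    unfold zNorm2
    congr 1
    rw [Fintype.sum_sum_type, Finset.sum_add_distrib]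
    simp [e, MeasurableEquiv.sumPiEquivProdPi, Equiv.sumPiEquivProdPi]
  have hmeas : Measurable (zNorm2 (n := n)) := by
    unfold zNorm2
    fun_prop
  have hS : MeasurableSet {z : (Fin n → ℝ) × (Fin n → ℝ) | zNorm2 z < R} :=
    measurableSet_lt hmeas measurable_const
  rw [← integral_indicator hS, ← he.integral_comp e.measurableEmbedding]
  have h1 : (fun x => ({z : (Fin n → ℝ) × (Fin n → ℝ) | zNorm2 z < R}.indicator
      (fun z => g (zNorm2 z))) (e x)) = fun x => (Iio R).indicator g ‖x‖ := by
    funext x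
    simp only [indicator, mem_setOf_eq, hnorm, mem_Iio]
  rw [h1, integral_fun_norm_addHaar volume ((Iio R).indicator g)]
  have hd : Module.finrank ℝ (EuclideanSpace ℝ (Fin n ⊕ Fin n)) = 2 * n := by
    simp; ring
  rw [hd]
  have h2 : (∫ y in Ioi (0:ℝ), y ^ (2 * n - 1) • (Iio R).indicator g y)
      = ∫ y in Ioo 0 R, y ^ (2 * n - 1) * g y := by
    have : (fun y : ℝ => y ^ (2 * n - 1) • (Iio R).indicator g y)
        = (Iio R).indicator (fun y => y ^ (2 * n - 1) * g y) := by
      funext y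
      by_cases h : y < R <;> simp [h]
    rw [this, setIntegral_indicator measurableSet_Iio]
    rfl
  rw [h2]
  simp [mul_assoc]

lemma aux_sqrt_deriv (lam : ℝ) (r : ℝ) (h : 0 < 1 - lam ^ 2 * r ^ 2) :
    HasDerivAt (fun r => Real.sqrt (1 - lam ^ 2 * r ^ 2))
      (-(lam ^ 2 * r) * (Real.sqrt (1 - lam ^ 2 * r ^ 2))⁻¹) r := by
  have h1 : HasDerivAt (fun r : ℝ => 1 - lam ^ 2 * r ^ 2) (-(lam ^ 2 * (2 * r))) r := by
    simpa using ((hasDerivAt_pow 2 r).const_mul (lam ^ 2)).const_sub 1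
  have hs := Real.sqrt_pos.2 h
  convert h1.sqrt h.ne' using 1
  field_simp

lemma aux_profile_deriv (lam : ℝ) (hlam : 0 < lam) (r : ℝ) (h0 : 0 < r)
    (h : 0 < 1 - lam ^ 2 * r ^ 2) :
    HasDerivAt (pansuProfile lam) (-lam * r ^ 2 * (Real.sqrt (1 - lam ^ 2 * r ^ 2))⁻¹) r := by
  have hs := Real.sqrt_pos.2 h
  have hsq := Real.sq_sqrt h.le
  have hl : HasDerivAt (fun r : ℝ => lam * r) lam r := by
    simpa using (hasDerivAt_id r).const_mul lam
  have hlt : lam * r < 1 := by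
    by_contra hc
    nlinarith
  have hpos : 0 < lam * r := by positivity
  have ha := (Real.hasDerivAt_arccos (x := lam * r) (by linarith) hlt.ne).comp r hl
  have := ((hl.mul (aux_sqrt_deriv lam r h)).add ha).const_mul (1 / (2 * lam ^ 2))
  have hf : HasDerivAt (pansuProfile lam) _ r := this
  convert hf using 1
  rw [show (lam * r) ^ 2 = lam ^ 2 * r ^ 2 by ring]
  field_simp
  rw [hsq]
  ring

lemma aux_one_dim (n : ℕ) (hn : 1 ≤ n) (lam : ℝ) (hlam : 0 < lam) :
    (∫ y in Ioo 0 (1 / lam), y ^ (2 * n - 1) * (y * (Real.sqrt (1 - lam ^ 2 * y ^ 2))⁻¹))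
      = 2 * n * lam * (∫ y in Ioo 0 (1 / lam), y ^ (2 * n - 1) * pansuProfile lam y)
        + ∫ y in Ioo 0 (1 / lam), y ^ (2 * n - 1) * (y * Real.sqrt (1 - lam ^ 2 * y ^ 2)) := by
  have hR : 0 < 1 / lam := by positivity
  have hpos : ∀ r ∈ Ioo 0 (1 / lam), 0 < 1 - lam ^ 2 * r ^ 2 := by
    intro r hr
    have h1 : lam * r < 1 := by
      have := hr.2
      rw [lt_div_iff₀ hlam] at this
      linarith
    have h2 : 0 < lam * r := mul_pos hlam hr.1
    nlinarith
  have hprof : Continuous (pansuProfile lam) := by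
    unfold pansuProfile
    fun_prop
  simp only [← integral_Ioc_eq_integral_Ioo, ← intervalIntegral.integral_of_le hR.le]
  have i0 : IntervalIntegrable (fun y => y * (Real.sqrt (1 - lam ^ 2 * y ^ 2))⁻¹) volume
      0 (1 / lam) := by
    apply intervalIntegral.intervalIntegrable_deriv_of_nonneg
      (g := fun y => - (1 / lam ^ 2) * Real.sqrt (1 - lam ^ 2 * y ^ 2))
    · fun_prop
    · intro x hx
      rw [min_eq_left hR.le, max_eq_right hR.le] at hx
      refine ((aux_sqrt_deriv lam x (hpos x hx)).const_mul (-(1 / lam ^ 2))).congr_deriv ?_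
      field_simp
    · intro x hx
      rw [min_eq_left hR.le, max_eq_right hR.le] at hx
      have := hx.1
      positivity
  have i1 : IntervalIntegrable
      (fun y => y ^ (2 * n - 1) * (y * (Real.sqrt (1 - lam ^ 2 * y ^ 2))⁻¹)) volume
      0 (1 / lam) := i0.continuousOn_mul (by fun_prop)
  have i2 : IntervalIntegrable (fun y => y ^ (2 * n - 1) * pansuProfile lam y) volume
      0 (1 / lam) := (by fun_prop : Continuous _).intervalIntegrable _ _
  have i3 : IntervalIntegrable
      (fun y => y ^ (2 * n - 1) * (y * Real.sqrt (1 - lam ^ 2 * y ^ 2))) volume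
      0 (1 / lam) := (by fun_prop : Continuous _).intervalIntegrable _ _
  have i4 := (i1.sub (i2.const_mul (2 * n * lam))).sub i3
  have key := intervalIntegral.integral_eq_sub_of_hasDerivAt_of_le hR.le
    (f := fun y => -lam * (y ^ (2 * n) * pansuProfile lam y)) (by fun_prop)
    (f' := fun y => y ^ (2 * n - 1) * (y * (Real.sqrt (1 - lam ^ 2 * y ^ 2))⁻¹)
      - 2 * n * lam * (y ^ (2 * n - 1) * pansuProfile lam y)
      - y ^ (2 * n - 1) * (y * Real.sqrt (1 - lam ^ 2 * y ^ 2)))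
    (by
      intro x hx
      have h := hpos x hx
      have hs := Real.sqrt_pos.2 h
      have hsq := Real.sq_sqrt h.le
      refine (((hasDerivAt_pow (2 * n) x).mul
        (aux_profile_deriv lam hlam x hx.1 h)).const_mul (-lam)).congr_deriv ?_
      obtain ⟨m, rfl⟩ : ∃ m, n = m + 1 := ⟨n - 1, by omega⟩
      rw [show 2 * (m + 1) - 1 = 2 * m + 1 by omega, show 2 * (m + 1) = 2 * m + 1 + 1 by ring,
        pow_succ x (2 * m + 1)]
      push_cast
      generalize x ^ (2 * m + 1) = X
      field_simp
      rw [hsq]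
      ring) i4
  rw [intervalIntegral.integral_sub (i1.sub (i2.const_mul _)) i3,
    intervalIntegral.integral_sub i1 (i2.const_mul _),
    intervalIntegral.integral_const_mul] at key
  have hend : pansuProfile lam (1 / lam) = 0 := by
    unfold pansuProfile
    have : lam * (1 / lam) = 1 := by field_simp
    have h2 : lam ^ 2 * (1 / lam) ^ 2 = 1 := by field_simp
    rw [this, h2]
    simp
  have hz : (0:ℝ) ^ (2 * n) = 0 := zero_pow (by omega)
  simp only [hend, hz] at key
  linarith

/-- Divergence-theorem identity on the half-ball: over the
open disk `D = {|z| < 1/λ}` in `ℝ^{2n}`,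
`∫_D |z|(1−λ²|z|²)^{−1/2} dz = 2nλ·∫_D f_λ(|z|) dz + ∫_D |z|(1−λ²|z|²)^{1/2} dz`. -/
theorem hemisphere_area_volume_flux_identity
    (n : ℕ) (hn : 1 ≤ n) (lam : ℝ) (hlam : 0 < lam) :
    (∫ z in {z : (Fin n → ℝ) × (Fin n → ℝ) | zNorm2 z < 1 / lam},
        zNorm2 z * (Real.sqrt (1 - lam ^ 2 * zNorm2 z ^ 2))⁻¹)
      = 2 * n * lam * (∫ z in {z : (Fin n → ℝ) × (Fin n → ℝ) | zNorm2 z < 1 / lam},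
          pansuProfile lam (zNorm2 z))
        + ∫ z in {z : (Fin n → ℝ) × (Fin n → ℝ) | zNorm2 z < 1 / lam},
            zNorm2 z * Real.sqrt (1 - lam ^ 2 * zNorm2 z ^ 2) := by
  rw [aux_radial n hn (1 / lam) (fun y => y * (Real.sqrt (1 - lam ^ 2 * y ^ 2))⁻¹),
    aux_radial n hn (1 / lam) (pansuProfile lam),
    aux_radial n hn (1 / lam) (fun y => y * Real.sqrt (1 - lam ^ 2 * y ^ 2)),
    aux_one_dim n hn lam hlam]
  ring

end
end

section
/- In the first Heisenberg group ℍ¹ (n = 1), for every λ > 0 the Pansu ball satisfies P(B_λ) = π²/λ³ and |B_λ| = 3π²/(8λ⁴). In particular, the scale-invariant ratio satisfies P(B_λ)⁴/|B_λ|³ = (π²)⁴/(3π²/8)³ = 512π²/27 for every λ > 0. -/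
open MeasureTheory Real Filter Set
open scoped BigOperators ENNReal NNReal Topology

noncomputable section

/-- Planar radius. -/
def prho (z : ℝ × ℝ) : ℝ := √(z.1 ^ 2 + z.2 ^ 2)

lemma prho_nonneg (z : ℝ × ℝ) : 0 ≤ prho z := Real.sqrt_nonneg _

lemma prho_sq (z : ℝ × ℝ) : prho z ^ 2 = z.1 ^ 2 + z.2 ^ 2 :=
  Real.sq_sqrt (by positivity)

lemma continuous_prho : Continuous prho := by
  unfold prho; fun_prop

/-- The weight `√(1 - λ²ρ²)`. -/
def pw (lam ρ : ℝ) : ℝ := √(1 - lam ^ 2 * ρ ^ 2)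

lemma continuous_pw (lam : ℝ) : Continuous (pw lam) := by
  unfold pw; fun_prop

lemma pw_nonneg (lam ρ : ℝ) : 0 ≤ pw lam ρ := Real.sqrt_nonneg _

lemma pw_pos {lam ρ : ℝ} (hl : 0 < lam) (h0 : 0 ≤ ρ) (h : lam * ρ < 1) : 0 < pw lam ρ := by
  apply Real.sqrt_pos.2
  have : 0 ≤ lam * ρ := by positivity
  nlinarith

lemma pw_sq {lam ρ : ℝ} (hl : 0 < lam) (h0 : 0 ≤ ρ) (h : lam * ρ ≤ 1) :
    pw lam ρ ^ 2 = 1 - lam ^ 2 * ρ ^ 2 := by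
  apply Real.sq_sqrt
  have : 0 ≤ lam * ρ := by positivity
  nlinarith

lemma pw_zero {lam ρ : ℝ} (h : 1 ≤ lam * ρ) : pw lam ρ = 0 := by
  apply Real.sqrt_eq_zero_of_nonpos
  nlinarith

lemma profile_eq (lam ρ : ℝ) :
    pansuProfile lam ρ = (1 / (2 * lam ^ 2)) * (lam * ρ * pw lam ρ + Real.arccos (lam * ρ)) := rfl

lemma profile_zero {lam ρ : ℝ} (h : 1 ≤ lam * ρ) : pansuProfile lam ρ = 0 := by
  rw [profile_eq, pw_zero h, Real.arccos_eq_zero.2 h]; simp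

lemma profile_nonneg {lam ρ : ℝ} (hl : 0 < lam) (h0 : 0 ≤ ρ) : 0 ≤ pansuProfile lam ρ := by
  rw [profile_eq]
  have := pw_nonneg lam ρ
  have := Real.arccos_nonneg (lam * ρ)
  positivity

lemma profile_pos {lam ρ : ℝ} (hl : 0 < lam) (h0 : 0 ≤ ρ) (h : lam * ρ < 1) :
    0 < pansuProfile lam ρ := by
  rw [profile_eq]
  have := pw_nonneg lam ρ
  have := Real.arccos_pos.2 h
  positivity

lemma continuous_profile (lam : ℝ) : Continuous (pansuProfile lam) := by
  unfold pansuProfile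
  have := Real.continuous_arccos
  fun_prop

lemma hasDerivAt_pw {lam ρ : ℝ} (hl : 0 < lam) (h0 : 0 ≤ ρ) (h : lam * ρ < 1) :
    HasDerivAt (pw lam) (-(lam ^ 2 * ρ) / pw lam ρ) ρ := by
  have hp := pw_pos hl h0 h
  have h1 : HasDerivAt (fun ρ : ℝ => 1 - lam ^ 2 * ρ ^ 2) (-(lam ^ 2 * (2 * ρ))) ρ := by
    have := ((hasDerivAt_pow 2 ρ).const_mul (lam ^ 2)).const_sub 1
    simpa using this
  have h2 := h1.sqrt (by have := Real.sqrt_pos.1 hp; exact this.ne')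
  refine h2.congr_deriv ?_
  change -(lam ^ 2 * (2 * ρ)) / (2 * pw lam ρ) = _
  field_simp

lemma hasDerivAt_arccos_mul {lam ρ : ℝ} (hl : 0 < lam) (h0 : 0 ≤ ρ) (h : lam * ρ < 1) :
    HasDerivAt (fun ρ => Real.arccos (lam * ρ)) (-lam / pw lam ρ) ρ := by
  have hp := pw_pos hl h0 h
  have : 0 ≤ lam * ρ := by positivity
  have h2 := (Real.hasDerivAt_arccos (x := lam * ρ) (by linarith) (by linarith)).comp ρ
    ((hasDerivAt_id ρ).const_mul lam)
  refine h2.congr_deriv ?_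
  rw [mul_pow]
  change -(1 / pw lam ρ) * (lam * 1) = _
  field_simp

lemma hasDerivAt_profile {lam ρ : ℝ} (hl : 0 < lam) (h0 : 0 ≤ ρ) (h : lam * ρ ≠ 1) :
    HasDerivAt (pansuProfile lam) (-(lam * ρ ^ 2) / pw lam ρ) ρ := by
  rcases lt_or_gt_of_ne h with h | h
  · have hp := pw_pos hl h0 h
    have hs := pw_sq hl h0 h.le
    have h2 := (((((hasDerivAt_id ρ).const_mul lam).mul (hasDerivAt_pw hl h0 h)).add
      (hasDerivAt_arccos_mul hl h0 h)).const_mul (1 / (2 * lam ^ 2)))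
    refine HasDerivAt.congr_deriv (f := pansuProfile lam) h2 ?_
    simp only [id]
    field_simp
    rw [hs]; ring
  · rw [pw_zero h.le, div_zero]
    apply (hasDerivAt_const ρ (0 : ℝ)).congr_of_eventuallyEq
    have : ∀ᶠ r in 𝓝 ρ, 1 < lam * r :=
      (continuous_const.mul continuous_id).continuousAt.eventually (lt_mem_nhds h)
    filter_upwards [this] with r hr
    exact profile_zero hr.le

/-- One-dimensional integral via a primitive, in `lintegral` form. -/
lemma lintegral_Ioi_primitive {R : ℝ} (hR : 0 < R) (g g' : ℝ → ℝ) (hc : Continuous g)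
    (hd : ∀ x ∈ Ioo 0 R, HasDerivAt g (g' x) x) (hn : ∀ x ∈ Ioo 0 R, 0 ≤ g' x)
    (hz : ∀ x, R ≤ x → g' x = 0) :
    ∫⁻ x in Ioi (0 : ℝ), ENNReal.ofReal (g' x) = ENNReal.ofReal (g R - g 0) := by
  have hi : IntegrableOn g' (Ioc 0 R) volume :=
    intervalIntegral.integrableOn_deriv_of_nonneg hc.continuousOn hd hn
  have h1 := intervalIntegral.integral_eq_sub_of_hasDerivAt_of_le hR.le hc.continuousOn hd
    ((intervalIntegrable_iff_integrableOn_Ioc_of_le hR.le).2 hi)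
  rw [← h1, intervalIntegral.integral_of_le hR.le, ofReal_integral_eq_lintegral_ofReal hi]
  · rw [← Ioc_union_Ioi_eq_Ioi hR.le, lintegral_union measurableSet_Ioi]
    · rw [setLIntegral_congr_fun (g := fun _ => 0) (s := Ioi R) measurableSet_Ioi]
      · simp
      · intro x hx; simp [hz x (le_of_lt hx)]
    · rw [Set.disjoint_left]; intro x hx hx'; exact absurd hx' (not_lt.2 hx.2)
  · rw [EventuallyLE, ae_restrict_iff' measurableSet_Ioc]
    refine Eventually.of_forall fun x hx => ?_
    rcases hx.2.lt_or_eq with h | h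
    · exact hn x ⟨hx.1, h⟩
    · simp [h, hz R le_rfl]

lemma lintegral_radial (h : ℝ → ℝ) (hm : Measurable h) :
    ∫⁻ z : ℝ × ℝ, ENNReal.ofReal (h (prho z))
      = ENNReal.ofReal (2 * π) * ∫⁻ r in Ioi (0 : ℝ), ENNReal.ofReal (r * h r) := by
  rw [← lintegral_comp_polarCoord_symm]
  have e : polarCoord.target = Ioi (0 : ℝ) ×ˢ Ioo (-π) π := rfl
  rw [e]
  rw [setLIntegral_congr_fun (g := fun p : ℝ × ℝ => ENNReal.ofReal (p.1 * h p.1))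
    (measurableSet_Ioi.prod measurableSet_Ioo)]
  · rw [Measure.volume_eq_prod, ← Measure.prod_restrict, lintegral_prod]
    · simp only [lintegral_const, MeasurableSet.univ, Measure.restrict_apply, univ_inter,
        Real.volume_Ioo]
      rw [lintegral_mul_const _ (by fun_prop), mul_comm]
      congr 2; ring
    · fun_prop
  · rintro ⟨r, θ⟩ ⟨hr, -⟩
    have hr : 0 < r := hr
    have : prho (polarCoord.symm (r, θ)) = r := by
      simp only [polarCoord_symm_apply, prho]
      rw [show (r * cos θ) ^ 2 + (r * sin θ) ^ 2 = r ^ 2 by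
        rw [mul_pow, mul_pow, ← mul_add, Real.cos_sq_add_sin_sq, mul_one], Real.sqrt_sq hr.le]
    simp only [this, smul_eq_mul]
    rw [ENNReal.ofReal_mul hr.le]

lemma lintegral_normal (lam : ℝ) (hl : 0 < lam) :
    ∫⁻ z : ℝ × ℝ, ENNReal.ofReal (prho z / pw lam (prho z))
      = ENNReal.ofReal (π ^ 2 / (2 * lam ^ 3)) := by
  rw [lintegral_radial (fun r => r / pw lam r) (measurable_id.div (continuous_pw lam).measurable)]
  rw [lintegral_Ioi_primitive (R := 1 / lam) (by positivity)
    (fun r => -(1 / (2 * lam ^ 3)) * (lam * r * pw lam r + Real.arccos (lam * r)))]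
  · rw [← ENNReal.ofReal_mul (by positivity)]
    congr 1
    rw [pw_zero (by field_simp; rfl)]
    simp
    field_simp
    norm_num
  · have := Real.continuous_arccos
    have := continuous_pw lam
    fun_prop
  · intro x hx
    have hx1 : lam * x < 1 := by have := hx.2; rwa [lt_div_iff₀ hl, mul_comm] at this
    have h := hasDerivAt_profile hl hx.1.le hx1.ne
    have h2 := h.const_mul (-(1 / lam))
    have hp := pw_pos hl hx.1.le hx1
    refine (HasDerivAt.congr_deriv (f' := -(1 / lam) * (-(lam * x ^ 2) / pw lam x)) ?_ ?_)
    · refine h2.congr_of_eventuallyEq (Eventually.of_forall fun r => ?_)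
      simp only [profile_eq]; field_simp
    · field_simp
  · intro x hx
    have := pw_nonneg lam x
    have := hx.1
    positivity
  · intro x hx
    rw [pw_zero (by rw [div_le_iff₀ hl] at hx; linarith)]; simp

lemma lintegral_profile (lam : ℝ) (hl : 0 < lam) :
    ∫⁻ z : ℝ × ℝ, ENNReal.ofReal (2 * pansuProfile lam (prho z))
      = ENNReal.ofReal (3 * π ^ 2 / (8 * lam ^ 4)) := by
  rw [lintegral_radial (fun r => 2 * pansuProfile lam r)
    (continuous_const.mul (continuous_profile lam)).measurable]
  rw [lintegral_Ioi_primitive (R := 1 / lam) (by positivity)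
    (fun r => r ^ 2 * pansuProfile lam r - (1 / lam ^ 4) *
      (3 / 8 * Real.arccos (lam * r) + lam * r * pw lam r * (3 / 8 + (lam * r) ^ 2 / 4)))]
  · rw [← ENNReal.ofReal_mul (by positivity)]
    congr 1
    rw [pw_zero (by field_simp; rfl), profile_zero (by field_simp; rfl)]
    simp
    field_simp
    norm_num
  · have := Real.continuous_arccos
    have := continuous_pw lam
    have := continuous_profile lam
    fun_prop
  · intro x hx
    have hx1 : lam * x < 1 := by have := hx.2; rwa [lt_div_iff₀ hl, mul_comm] at this
    have hp := pw_pos hl hx.1.le hx1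
    have hs := pw_sq hl hx.1.le hx1.le
    have h1 := (hasDerivAt_pow 2 x).mul (hasDerivAt_profile hl hx.1.le hx1.ne)
    have h2 := (hasDerivAt_arccos_mul hl hx.1.le hx1).const_mul (3 / 8)
    have h3 := ((hasDerivAt_id x).const_mul lam).mul (hasDerivAt_pw hl hx.1.le hx1)
    have h4 := ((((hasDerivAt_id x).const_mul lam).pow 2).div_const 4).const_add (3 / 8)
    have h5 := h1.sub ((h2.add (h3.mul h4)).const_mul (1 / lam ^ 4))
    refine HasDerivAt.congr_deriv h5 ?_
    simp only [id, Pi.mul_apply, Pi.pow_apply]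
    field_simp
    ring_nf
    simp only [hs]
    ring
  · intro x hx
    have := profile_nonneg hl hx.1.le
    have := hx.1
    positivity
  · intro x hx
    rw [profile_zero (by rw [div_le_iff₀ hl] at hx; linarith)]; simp

/-- Profile as function on the plane. -/
def pF (lam : ℝ) (z : ℝ × ℝ) : ℝ := pansuProfile lam (prho z)

lemma continuous_pF (lam : ℝ) : Continuous (pF lam) :=
  (continuous_profile lam).comp continuous_prho

lemma pF_nonneg {lam : ℝ} (hl : 0 < lam) (z : ℝ × ℝ) : 0 ≤ pF lam z :=
  profile_nonneg hl (prho_nonneg z)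

lemma pF_zero {lam : ℝ} {z : ℝ × ℝ} (h : 1 ≤ lam * prho z) : pF lam z = 0 := profile_zero h

lemma abs_le_prho (z : ℝ × ℝ) : ‖z‖ ≤ prho z := by
  rw [Prod.norm_def]
  apply max_le
  · apply Real.le_sqrt_of_sq_le; rw [Real.norm_eq_abs, sq_abs]; nlinarith [sq_nonneg z.2]
  · apply Real.le_sqrt_of_sq_le; rw [Real.norm_eq_abs, sq_abs]; nlinarith [sq_nonneg z.1]

lemma compactSupport_pF {lam : ℝ} (hl : 0 < lam) : HasCompactSupport (pF lam) := by
  apply HasCompactSupport.of_support_subset_isCompact (isCompact_closedBall (0 : ℝ × ℝ) (1 / lam))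
  intro z hz
  rw [mem_closedBall_zero_iff]
  by_contra h
  push Not at h
  apply hz
  apply pF_zero
  have := h.trans_le (abs_le_prho z)
  rw [div_lt_iff₀ hl] at this; linarith

/-- The gradient of the profile is `-pG • z`. -/
def pG (lam : ℝ) (z : ℝ × ℝ) : ℝ := lam * prho z / pw lam (prho z)

lemma pG_nonneg {lam : ℝ} (hl : 0 < lam) (z : ℝ × ℝ) : 0 ≤ pG lam z := by
  have := prho_nonneg z
  have := pw_nonneg lam (prho z)
  unfold pG; positivity

lemma pG_zero {lam : ℝ} {z : ℝ × ℝ} (h : 1 ≤ lam * prho z) : pG lam z = 0 := by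
  unfold pG; rw [pw_zero h]; simp

lemma measurable_pG (lam : ℝ) : Measurable (pG lam) := by
  unfold pG
  exact (continuous_const.mul continuous_prho).measurable.div
    ((continuous_pw lam).comp continuous_prho).measurable

/-- The gradient of the planar profile. -/
def pL (lam : ℝ) (z : ℝ × ℝ) : (ℝ × ℝ) →L[ℝ] ℝ :=
  -(pG lam z) • (z.1 • ContinuousLinearMap.fst ℝ ℝ ℝ + z.2 • ContinuousLinearMap.snd ℝ ℝ ℝ)

lemma pL_apply (lam : ℝ) (z v : ℝ × ℝ) : pL lam z v = -(pG lam z) * (z.1 * v.1 + z.2 * v.2) := by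
  simp [pL]; ring

lemma hasFDerivAt_pF {lam : ℝ} (hl : 0 < lam) {z : ℝ × ℝ} (h0 : prho z ≠ 0)
    (h1 : lam * prho z ≠ 1) : HasFDerivAt (pF lam) (pL lam z) z := by
  have hn : z.1 ^ 2 + z.2 ^ 2 ≠ 0 := by rw [← prho_sq]; positivity
  have hf : HasFDerivAt (fun z : ℝ × ℝ => z.1) (ContinuousLinearMap.fst ℝ ℝ ℝ) z := hasFDerivAt_fst
  have hs : HasFDerivAt (fun z : ℝ × ℝ => z.2) (ContinuousLinearMap.snd ℝ ℝ ℝ) z := hasFDerivAt_snd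
  have hr : HasFDerivAt prho _ z := ((hf.pow 2).add (hs.pow 2)).sqrt hn
  have := (hasDerivAt_profile hl (prho_nonneg z) h1).comp_hasFDerivAt z hr
  refine this.congr_fderiv ?_
  ext
  · simp [pL, pG]
    change -(lam * prho z ^ 2) / pw lam (prho z) * ((prho z)⁻¹ * 2⁻¹ * (2 * z.1)) = _
    field_simp
  · simp [pL, pG]
    change -(lam * prho z ^ 2) / pw lam (prho z) * ((prho z)⁻¹ * 2⁻¹ * (2 * z.2)) = _
    field_simp

lemma integrable_normal {lam : ℝ} (hl : 0 < lam) :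
    Integrable (fun z : ℝ × ℝ => prho z / pw lam (prho z)) := by
  refine ⟨?_, ?_⟩
  · exact (continuous_prho.measurable.div
      ((continuous_pw lam).comp continuous_prho).measurable).aestronglyMeasurable
  · rw [hasFiniteIntegral_iff_ofReal, lintegral_normal lam hl]
    · exact ENNReal.ofReal_lt_top
    · exact Eventually.of_forall fun z => div_nonneg (prho_nonneg z) (pw_nonneg _ _)

lemma integral_normal {lam : ℝ} (hl : 0 < lam) :
    ∫ z : ℝ × ℝ, prho z / pw lam (prho z) = π ^ 2 / (2 * lam ^ 3) := by
  rw [integral_eq_lintegral_of_nonneg_ae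
    (Eventually.of_forall fun z => div_nonneg (prho_nonneg z) (pw_nonneg _ _))
    (integrable_normal hl).1, lintegral_normal lam hl, ENNReal.toReal_ofReal (by positivity)]

lemma measurable_pL (lam : ℝ) (v : ℝ × ℝ) : Measurable (fun z => pL lam z v) := by
  simp only [pL_apply]
  have := measurable_pG lam
  fun_prop

lemma pG_le {lam : ℝ} (hl : 0 < lam) (z : ℝ × ℝ) :
    pG lam z * prho z ≤ prho z / pw lam (prho z) := by
  rcases le_or_gt 1 (lam * prho z) with h | h
  · rw [pG_zero h, pw_zero h]; simp
  · have := pw_pos hl (prho_nonneg z) h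
    unfold pG
    rw [div_mul_eq_mul_div]
    apply div_le_div_of_nonneg_right _ this.le
    nlinarith [prho_nonneg z]

lemma norm_pL_le {lam : ℝ} (hl : 0 < lam) (v z : ℝ × ℝ) :
    ‖pL lam z v‖ ≤ 2 * ‖v‖ * (prho z / pw lam (prho z)) := by
  rw [pL_apply, norm_mul, norm_neg, Real.norm_of_nonneg (pG_nonneg hl z)]
  have h1 : ‖z.1 * v.1 + z.2 * v.2‖ ≤ 2 * ‖v‖ * prho z := by
    refine (norm_add_le _ _).trans ?_
    rw [norm_mul, norm_mul]
    have a1 := (norm_fst_le z).trans (abs_le_prho z)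
    have a2 := (norm_snd_le z).trans (abs_le_prho z)
    have b1 := norm_fst_le v
    have b2 := norm_snd_le v
    have c1 := mul_le_mul a1 b1 (norm_nonneg _) (prho_nonneg z)
    have c2 := mul_le_mul a2 b2 (norm_nonneg _) (prho_nonneg z)
    linarith
  calc _ ≤ pG lam z * (2 * ‖v‖ * prho z) := mul_le_mul_of_nonneg_left h1 (pG_nonneg hl z)
    _ = 2 * ‖v‖ * (pG lam z * prho z) := by ring
    _ ≤ _ := mul_le_mul_of_nonneg_left (pG_le hl z) (by positivity)

lemma integrable_pL {lam : ℝ} (hl : 0 < lam) (v : ℝ × ℝ) : Integrable (fun z => pL lam z v) :=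
  ((integrable_normal hl).const_mul (2 * ‖v‖)).mono' (measurable_pL lam v).aestronglyMeasurable
    (Eventually.of_forall (norm_pL_le hl v))

/-- Integral of a derivative over the line vanishes. -/
lemma integral_deriv_line (g g' : ℝ → ℝ) (s : Set ℝ) (hs : s.Countable) (hc : Continuous g)
    (hcs : HasCompactSupport g) (hd : ∀ x, x ∉ s → HasDerivAt g (g' x) x)
    (hi : Integrable g') : ∫ x, g' x = 0 := by
  have h1 := intervalIntegral_tendsto_integral (l := atTop) hi (a := fun x : ℝ => -x) (b := fun x => x)
    tendsto_neg_atTop_atBot tendsto_id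
  have h2 : (fun x : ℝ => ∫ t in (-x)..x, g' t) = fun x => g x - g (-x) := by
    funext x
    exact integral_eq_of_hasDerivAt_off_countable g g' hs hc.continuousOn
      (fun x hx => hd x hx.2) hi.intervalIntegrable
  rw [h2] at h1
  have hz := hcs.is_zero_at_infty
  have h3 : Tendsto (fun x => g x - g (-x)) atTop (𝓝 (0 - 0)) := by
    apply Tendsto.sub
    · exact hz.mono_left atTop_le_cocompact
    · exact (hz.mono_left atBot_le_cocompact).comp tendsto_neg_atTop_atBot
  rw [sub_zero] at h3
  exact tendsto_nhds_unique h1 h3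

lemma countable_sq (c d : ℝ) : {x : ℝ | x ^ 2 + c = d}.Countable := by
  apply Set.Countable.mono (s₂ := {√(d - c), -√(d - c)})
  · intro x hx
    have hx : x ^ 2 + c = d := hx
    have : √(d - c) = |x| := by rw [← hx, add_sub_cancel_right, Real.sqrt_sq_eq_abs]
    rw [this]
    rcases abs_cases x with h | h <;> simp [h.1]
  · exact (Set.toFinite _).countable

lemma countable_sq' (c d : ℝ) : {x : ℝ | c + x ^ 2 = d}.Countable := by
  simp only [add_comm c]; exact countable_sq c d

lemma good_of {lam : ℝ} (hl : 0 < lam) {z : ℝ × ℝ} (h0 : z.1 ^ 2 + z.2 ^ 2 ≠ 0)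
    (h1 : z.1 ^ 2 + z.2 ^ 2 ≠ 1 / lam ^ 2) : prho z ≠ 0 ∧ lam * prho z ≠ 1 := by
  rw [← prho_sq] at h0 h1
  refine ⟨fun h => h0 (by simp [h]), fun h => h1 ?_⟩
  have : prho z = 1 / lam := by field_simp; linarith
  rw [this]; ring

lemma integral_deriv_fst {lam : ℝ} (hl : 0 < lam) (g : ℝ × ℝ → ℝ) (g' : ℝ × ℝ → (ℝ × ℝ) →L[ℝ] ℝ)
    (hc : Continuous g) (hcs : HasCompactSupport g)
    (hd : ∀ z, prho z ≠ 0 → lam * prho z ≠ 1 → HasFDerivAt g (g' z) z)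
    (hi : Integrable (fun z => g' z (1, 0))) : ∫ z, g' z (1, 0) = 0 := by
  rw [Measure.volume_eq_prod] at hi ⊢
  rw [integral_prod_symm _ hi]
  apply integral_eq_zero_of_ae
  filter_upwards [hi.prod_left_ae] with y hy
  apply integral_deriv_line (fun x => g (x, y)) _ _
    ((countable_sq (y ^ 2) 0).union (countable_sq (y ^ 2) (1 / lam ^ 2))) (by fun_prop) _ _ hy
  · exact hcs.comp_isClosedEmbedding
      (Topology.IsClosedEmbedding.of_continuous_injective_isClosedMap (by fun_prop)
        (fun a b h => (Prod.ext_iff.1 h).1) (isClosedMap_prodMk_right y))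
  · intro x hx
    simp only [mem_union, not_or, Set.mem_ofPred_eq] at hx
    obtain ⟨h0, h1⟩ := good_of hl (z := (x, y)) hx.1 hx.2
    exact (hd _ h0 h1).comp_hasDerivAt x ((hasDerivAt_id x).prodMk (hasDerivAt_const x y))

lemma integral_deriv_snd {lam : ℝ} (hl : 0 < lam) (g : ℝ × ℝ → ℝ) (g' : ℝ × ℝ → (ℝ × ℝ) →L[ℝ] ℝ)
    (hc : Continuous g) (hcs : HasCompactSupport g)
    (hd : ∀ z, prho z ≠ 0 → lam * prho z ≠ 1 → HasFDerivAt g (g' z) z)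
    (hi : Integrable (fun z => g' z (0, 1))) : ∫ z, g' z (0, 1) = 0 := by
  rw [Measure.volume_eq_prod] at hi ⊢
  rw [integral_prod _ hi]
  apply integral_eq_zero_of_ae
  filter_upwards [hi.prod_right_ae] with x hx
  apply integral_deriv_line (fun y => g (x, y)) _ _
    ((countable_sq' (x ^ 2) 0).union (countable_sq' (x ^ 2) (1 / lam ^ 2))) (by fun_prop) _ _ hx
  · exact hcs.comp_isClosedEmbedding
      (Topology.IsClosedEmbedding.of_continuous_injective_isClosedMap (by fun_prop)
        (fun a b h => (Prod.ext_iff.1 h).2) (isClosedMap_prodMk_left x))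
  · intro y hy
    simp only [mem_union, not_or, Set.mem_ofPred_eq] at hy
    obtain ⟨h0, h1⟩ := good_of hl (z := (x, y)) hy.1 hy.2
    exact (hd _ h0 h1).comp_hasDerivAt y ((hasDerivAt_const y x).prodMk (hasDerivAt_id y))

lemma bounded_of_cs {X : Type*} [TopologicalSpace X] (g : X → ℝ) (hc : Continuous g)
    (hs : HasCompactSupport g) : ∃ C, 0 ≤ C ∧ ∀ x, ‖g x‖ ≤ C := by
  obtain ⟨C, hC⟩ := hs.exists_bound_of_continuous hc
  exact ⟨max C 0, le_max_right _ _, fun x => (hC x).trans (le_max_left _ _)⟩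

lemma continuous_fderiv_dir {V : Type*} [NormedAddCommGroup V] [NormedSpace ℝ V] {A : V → ℝ}
    (hA : ContDiff ℝ 1 A) (w : V) : Continuous (fun q => fderiv ℝ A q w) :=
  (hA.continuous_fderiv (by norm_num)).clm_apply continuous_const

lemma cs_fderiv_dir {V : Type*} [NormedAddCommGroup V] [NormedSpace ℝ V] {A : V → ℝ}
    (hs : HasCompactSupport A) (w : V) : HasCompactSupport (fun q => fderiv ℝ A q w) :=
  hs.fderiv_apply ℝ w

lemma slice_formula {lam : ℝ} (hl : 0 < lam) (v : ℝ × ℝ)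
    (hv : ∀ (g : ℝ × ℝ → ℝ) (g' : ℝ × ℝ → (ℝ × ℝ) →L[ℝ] ℝ), Continuous g → HasCompactSupport g →
      (∀ z, prho z ≠ 0 → lam * prho z ≠ 1 → HasFDerivAt g (g' z) z) →
      Integrable (fun z => g' z v) → ∫ z, g' z v = 0)
    (A : (ℝ × ℝ) × ℝ → ℝ) (hA : ContDiff ℝ 1 A) (hs : HasCompactSupport A) :
    ∫ z, ∫ t in (-pF lam z)..(pF lam z), fderiv ℝ A (z, t) (v, 0)
      = ∫ z, -(pL lam z v * (A (z, pF lam z) + A (z, -pF lam z))) := by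
  have cF := continuous_pF lam
  have cA := hA.continuous
  have c1 := continuous_fderiv_dir hA (v, (0 : ℝ))
  have c2 := continuous_fderiv_dir hA ((0 : ℝ × ℝ), (1 : ℝ))
  obtain ⟨C0, hC0, b0⟩ := bounded_of_cs A cA hs
  obtain ⟨C1, hC1, b1⟩ := bounded_of_cs _ c1 (cs_fderiv_dir hs (v, (0 : ℝ)))
  obtain ⟨C2, hC2, b2⟩ := bounded_of_cs _ c2 (cs_fderiv_dir hs ((0 : ℝ × ℝ), (1 : ℝ)))
  obtain ⟨CF, hCF, bF⟩ := bounded_of_cs _ cF (compactSupport_pF hl)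
  set g1 : (ℝ × ℝ) × ℝ → ℝ := fun p => pF lam p.1 * fderiv ℝ A (p.1, pF lam p.1 * p.2) (v, 0) with hg1
  set g2 : (ℝ × ℝ) × ℝ → ℝ := fun p => pL lam p.1 v * (A (p.1, pF lam p.1 * p.2)
    + p.2 * pF lam p.1 * fderiv ℝ A (p.1, pF lam p.1 * p.2) (0, 1)) with hg2
  set μ : Measure ℝ := volume.restrict (Ioc (-1) 1) with hμ
  have iF : Integrable (pF lam) := cF.integrable_of_hasCompactSupport (compactSupport_pF hl)
  have cg1 : Continuous g1 := by
    apply (cF.comp continuous_fst).mul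
    exact c1.comp (by fun_prop)
  have i1 : Integrable g1 (volume.prod μ) := by
    have : Integrable (fun p : (ℝ × ℝ) × ℝ => pF lam p.1 * C1) (volume.prod μ) :=
      iF.mul_prod (integrable_const C1)
    refine this.mono' cg1.aestronglyMeasurable (Eventually.of_forall fun p => ?_)
    rw [hg1, norm_mul, Real.norm_of_nonneg (pF_nonneg hl _)]
    exact mul_le_mul_of_nonneg_left (b1 _) (pF_nonneg hl _)
  have ch : Continuous (fun p : (ℝ × ℝ) × ℝ => A (p.1, pF lam p.1 * p.2)
    + p.2 * pF lam p.1 * fderiv ℝ A (p.1, pF lam p.1 * p.2) (0, 1)) := by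
    have : Continuous (fun p : (ℝ × ℝ) × ℝ => fderiv ℝ A (p.1, pF lam p.1 * p.2) (0, 1)) :=
      c2.comp (by fun_prop : Continuous (fun p : (ℝ × ℝ) × ℝ => (p.1, pF lam p.1 * p.2)))
    fun_prop
  have i2 : Integrable g2 (volume.prod μ) := by
    have : Integrable (fun p : (ℝ × ℝ) × ℝ => ‖pL lam p.1 v‖ * (C0 + 1 * CF * C2))
        (volume.prod μ) := (integrable_pL hl v).norm.mul_prod (integrable_const _)
    refine this.mono' ?_ ?_
    · exact ((measurable_pL lam v).comp measurable_fst).aestronglyMeasurable.mul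
        ch.aestronglyMeasurable
    · have hae : ∀ᵐ p : (ℝ × ℝ) × ℝ ∂(volume.prod μ), p.2 ∈ Ioc (-1 : ℝ) 1 := by
        have : ∀ᵐ s ∂μ, s ∈ Ioc (-1 : ℝ) 1 := ae_restrict_mem measurableSet_Ioc
        exact Measure.quasiMeasurePreserving_snd.ae this
      filter_upwards [hae] with p hp
      rw [hg2, norm_mul]
      apply mul_le_mul_of_nonneg_left _ (norm_nonneg _)
      refine (norm_add_le _ _).trans (add_le_add (b0 _) ?_)
      rw [norm_mul, norm_mul]
      have : ‖p.2‖ ≤ 1 := by rw [Real.norm_eq_abs, abs_le]; exact ⟨hp.1.le, hp.2⟩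
      exact mul_le_mul (mul_le_mul this (bF _) (norm_nonneg _) zero_le_one) (b2 _) (norm_nonneg _)
        (by positivity)
  have stepA : ∀ z, ∫ t in (-pF lam z)..(pF lam z), fderiv ℝ A (z, t) (v, 0) = ∫ s, g1 (z, s) ∂μ := by
    intro z
    have := intervalIntegral.mul_integral_comp_mul_left (a := -1) (b := 1)
      (f := fun t => fderiv ℝ A (z, t) (v, 0)) (pF lam z)
    rw [mul_neg_one, mul_one] at this
    rw [← this, ← intervalIntegral.integral_const_mul, intervalIntegral.integral_of_le (by norm_num)]
  have stepB : ∀ z, ∫ s, g2 (z, s) ∂μ = pL lam z v * (A (z, pF lam z) + A (z, -pF lam z)) := by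
    intro z
    rw [hμ, ← intervalIntegral.integral_of_le (by norm_num)]
    simp only [hg2]
    rw [intervalIntegral.integral_const_mul]
    congr 1
    rw [intervalIntegral.integral_eq_sub_of_hasDerivAt (f := fun s => s * A (z, pF lam z * s))]
    · simp
    · intro s _
      have hc : HasDerivAt (fun s : ℝ => (z, pF lam z * s)) ((0 : ℝ × ℝ), pF lam z) s := by
        have := ((hasDerivAt_id s).const_mul (pF lam z))
        rw [mul_one] at this
        exact (hasDerivAt_const s z).prodMk this
      have hd := ((hA.differentiable (by norm_num)) (z, pF lam z * s)).hasFDerivAt.comp_hasDerivAt s hc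
      refine ((hasDerivAt_id s).mul hd).congr_deriv ?_
      have : ((0 : ℝ × ℝ), pF lam z) = pF lam z • ((0 : ℝ × ℝ), (1 : ℝ)) := by simp
      rw [this, map_smul]
      simp only [id, one_mul, smul_eq_mul, Function.comp]
      ring
    · exact (ch.comp (by fun_prop : Continuous (fun s : ℝ => (z, s)))).intervalIntegrable _ _
  have stepD : ∫ z, ∫ s, (g1 (z, s) + g2 (z, s)) ∂μ = 0 := by
    have i12 := i1.add i2
    rw [integral_integral_swap (f := fun z s => g1 (z, s) + g2 (z, s)) i12]
    apply integral_eq_zero_of_ae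
    filter_upwards [i12.prod_left_ae] with s hs'
    set g' : ℝ × ℝ → (ℝ × ℝ) →L[ℝ] ℝ := fun z =>
      pF lam z • ((fderiv ℝ A (z, pF lam z * s)).comp
        ((ContinuousLinearMap.id ℝ (ℝ × ℝ)).prod (s • pL lam z)))
        + A (z, pF lam z * s) • pL lam z with hg'
    have e : ∀ z, g' z v = g1 (z, s) + g2 (z, s) := by
      intro z
      have : (v, s * pL lam z v) = (v, (0 : ℝ)) + (s * pL lam z v) • ((0 : ℝ × ℝ), (1 : ℝ)) := by simp
      simp [hg', hg1, hg2]
      rw [this, map_add, map_smul]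
      simp only [smul_eq_mul]
      ring
    have := hv (fun z => pF lam z * A (z, pF lam z * s)) g' (by fun_prop)
      ((compactSupport_pF hl).mul_right) ?_ ?_
    · simp only [e] at this; exact this
    · intro z h0 h1
      have hF := hasFDerivAt_pF hl h0 h1
      have hq : HasFDerivAt (fun z => (z, pF lam z * s))
          ((ContinuousLinearMap.id ℝ (ℝ × ℝ)).prod (s • pL lam z)) z :=
        (hasFDerivAt_id z).prodMk (hF.mul_const s)
      exact hF.mul (((hA.differentiable (by norm_num)) (z, pF lam z * s)).hasFDerivAt.comp z hq)
    · simp only [e]; exact hs'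
  have e3 : ∫ z, ∫ s, (g1 (z, s) + g2 (z, s)) ∂μ = (∫ z, ∫ s, g1 (z, s) ∂μ) + ∫ z, ∫ s, g2 (z, s) ∂μ := by
    rw [← integral_add i1.integral_prod_left i2.integral_prod_left]
    apply integral_congr_ae
    filter_upwards [i1.prod_right_ae, i2.prod_right_ae] with z h1 h2
    exact integral_add h1 h2
  rw [e3] at stepD
  simp only [stepA, integral_neg]
  simp only [stepB] at stepD
  linarith

/-- Coordinates on the first Heisenberg group. -/
def hIota : ((ℝ × ℝ) × ℝ) →L[ℝ] Hei 1 :=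
  (ContinuousLinearMap.pi fun _ => (ContinuousLinearMap.fst ℝ ℝ ℝ).comp
    (ContinuousLinearMap.fst ℝ (ℝ × ℝ) ℝ)).prod
  ((ContinuousLinearMap.pi fun _ => (ContinuousLinearMap.snd ℝ ℝ ℝ).comp
    (ContinuousLinearMap.fst ℝ (ℝ × ℝ) ℝ)).prod (ContinuousLinearMap.snd ℝ (ℝ × ℝ) ℝ))

lemma hIota_apply (q : (ℝ × ℝ) × ℝ) : hIota q = (fun _ => q.1.1, fun _ => q.1.2, q.2) := rfl

/-- The same map as a measurable equivalence. -/
def hEquiv : ((ℝ × ℝ) × ℝ) ≃ᵐ Hei 1 :=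
  MeasurableEquiv.prodAssoc.trans
    ((MeasurableEquiv.funUnique (Fin 1) ℝ).symm.prodCongr
      ((MeasurableEquiv.funUnique (Fin 1) ℝ).symm.prodCongr (MeasurableEquiv.refl ℝ)))

lemma hEquiv_eq : (hEquiv : (ℝ × ℝ) × ℝ → Hei 1) = hIota := by
  funext q
  rfl

lemma hIota_emb : MeasurableEmbedding hIota := by
  rw [← hEquiv_eq]; exact hEquiv.measurableEmbedding

lemma hIota_mp : MeasurePreserving hIota volume volume := by
  have h1 := (volume_preserving_funUnique (Fin 1) ℝ).symm
  have h2 : MeasurePreserving (MeasurableEquiv.prodAssoc : (ℝ × ℝ) × ℝ ≃ᵐ ℝ × ℝ × ℝ) volume volume :=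
    volume_preserving_prodAssoc
  exact (h1.prod (h1.prod (MeasurePreserving.id volume))).comp h2

/-- The Pansu ball in the coordinates of `(ℝ × ℝ) × ℝ`. -/
def pE (lam : ℝ) : Set ((ℝ × ℝ) × ℝ) := {q | prho q.1 ≤ 1 / lam ∧ |q.2| ≤ pF lam q.1}

lemma preimage_ball (lam : ℝ) : hIota ⁻¹' (pansuBall 1 lam) = pE lam := by
  ext q
  simp [pansuBall, pE, hIota_apply, zNorm, pF, prho]

lemma measurableSet_pE (lam : ℝ) : MeasurableSet (pE lam) := by
  have := continuous_prho
  have := continuous_pF lam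
  apply IsClosed.measurableSet
  apply IsClosed.inter
  · exact isClosed_le (f := fun q : (ℝ × ℝ) × ℝ => prho q.1) (g := fun _ => 1 / lam)
      (by fun_prop) (by fun_prop)
  · exact isClosed_le (f := fun q : (ℝ × ℝ) × ℝ => |q.2|) (g := fun q => pF lam q.1)
      (by fun_prop) (by fun_prop)

lemma slice_pE {lam : ℝ} (hl : 0 < lam) (z : ℝ × ℝ) :
    Prod.mk z ⁻¹' (pE lam) = if prho z ≤ 1 / lam then Icc (-pF lam z) (pF lam z) else ∅ := by
  split_ifs with h
  · ext t; simp only [pE, mem_preimage, mem_Icc, ← abs_le]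
    exact ⟨fun h' => h'.2, fun h' => ⟨h, h'⟩⟩
  · ext t; simp only [pE, mem_preimage, mem_empty_iff_false, iff_false]
    exact fun h' => h h'.1

lemma pF_zero' {lam : ℝ} (hl : 0 < lam) {z : ℝ × ℝ} (h : ¬ prho z ≤ 1 / lam) : pF lam z = 0 := by
  apply pF_zero
  push Not at h
  rw [div_lt_iff₀ hl] at h; linarith

lemma volume_ball {lam : ℝ} (hl : 0 < lam) :
    volume (pansuBall 1 lam) = ENNReal.ofReal (3 * π ^ 2 / (8 * lam ^ 4)) := by
  rw [← hIota_mp.measure_preimage_emb hIota_emb, preimage_ball, Measure.volume_eq_prod,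
    Measure.prod_apply (measurableSet_pE lam), ← lintegral_profile lam hl]
  apply lintegral_congr
  intro z
  rw [slice_pE hl]
  split_ifs with h
  · rw [Real.volume_Icc]; congr 1; unfold pF; ring
  · have := pF_zero' hl h
    unfold pF at this
    simp [this]

lemma slicing {lam : ℝ} (hl : 0 < lam) (g : (ℝ × ℝ) × ℝ → ℝ) (hi : Integrable g) :
    Integrable (fun z => ∫ t in (-pF lam z)..(pF lam z), g (z, t)) ∧
    ∫ q in pE lam, g q = ∫ z, ∫ t in (-pF lam z)..(pF lam z), g (z, t) := by
  have hi' := hi.indicator (measurableSet_pE lam)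
  rw [Measure.volume_eq_prod] at hi'
  have e : ∀ z, ∫ t, (pE lam).indicator g (z, t) = ∫ t in (-pF lam z)..(pF lam z), g (z, t) := by
    intro z
    have e1 : (fun t => (pE lam).indicator g (z, t))
        = (Prod.mk z ⁻¹' (pE lam)).indicator (fun t => g (z, t)) := by
      rfl
    rw [e1, integral_indicator ((measurableSet_pE lam).preimage measurable_prodMk_left), slice_pE hl]
    split_ifs with h
    · rw [integral_Icc_eq_integral_Ioc, intervalIntegral.integral_of_le]
      have := pF_nonneg hl z
      linarith
    · simp [pF_zero' hl h]
  constructor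
  · have := hi'.integral_prod_left
    simpa only [e] using this
  · rw [← integral_indicator (measurableSet_pE lam), Measure.volume_eq_prod, integral_prod _ hi']
    simp only [e]

/-- Flux density. -/
def pFlux (lam : ℝ) (A B : (ℝ × ℝ) × ℝ → ℝ) (z : ℝ × ℝ) : ℝ :=
  pG lam z * z.1 * (A (z, pF lam z) + A (z, -pF lam z))
  + z.2 * (A (z, pF lam z) - A (z, -pF lam z))
  + pG lam z * z.2 * (B (z, pF lam z) + B (z, -pF lam z))
  - z.1 * (B (z, pF lam z) - B (z, -pF lam z))

lemma vert {lam : ℝ} (c : ℝ × ℝ → ℝ) (A : (ℝ × ℝ) × ℝ → ℝ) (hA : ContDiff ℝ 1 A) (z : ℝ × ℝ) :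
    ∫ t in (-pF lam z)..(pF lam z), c z * fderiv ℝ A (z, t) (0, 1)
      = c z * (A (z, pF lam z) - A (z, -pF lam z)) := by
  rw [intervalIntegral.integral_const_mul]
  congr 1
  apply intervalIntegral.integral_eq_sub_of_hasDerivAt (f := fun t => A (z, t))
  · intro t _
    exact ((hA.differentiable (by norm_num)) (z, t)).hasFDerivAt.comp_hasDerivAt t
      ((hasDerivAt_const t z).prodMk (hasDerivAt_id t))
  · exact ((continuous_fderiv_dir hA ((0 : ℝ × ℝ), (1 : ℝ))).comp
      (by fun_prop : Continuous (fun s : ℝ => (z, s)))).intervalIntegrable _ _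

lemma integrable_side {lam : ℝ} (hl : 0 < lam) (v : ℝ × ℝ) (A : (ℝ × ℝ) × ℝ → ℝ)
    (cA : Continuous A) (hs : HasCompactSupport A) :
    Integrable (fun z => -(pL lam z v * (A (z, pF lam z) + A (z, -pF lam z)))) := by
  obtain ⟨C0, hC0, b0⟩ := bounded_of_cs A cA hs
  have cF := continuous_pF lam
  apply Integrable.neg
  apply ((integrable_pL hl v).norm.mul_const (C0 + C0)).mono'
  · exact (measurable_pL lam v).aestronglyMeasurable.mul
      (by fun_prop : Continuous fun z => A (z, pF lam z) + A (z, -pF lam z)).aestronglyMeasurable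
  · refine Eventually.of_forall fun z => ?_
    rw [norm_mul]
    exact mul_le_mul_of_nonneg_left ((norm_add_le _ _).trans (add_le_add (b0 _) (b0 _)))
      (norm_nonneg _)

lemma integral_four {X : Type*} [MeasurableSpace X] (μ : Measure X) {f1 f2 f3 f4 : X → ℝ}
    (h1 : Integrable f1 μ) (h2 : Integrable f2 μ) (h3 : Integrable f3 μ) (h4 : Integrable f4 μ) :
    ∫ x, (f1 x + f2 x + (f3 x - f4 x)) ∂μ
      = ∫ x, f1 x ∂μ + ∫ x, f2 x ∂μ + (∫ x, f3 x ∂μ - ∫ x, f4 x ∂μ) := by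
  rw [integral_add (f := fun x => f1 x + f2 x) (g := fun x => f3 x - f4 x) (h1.add h2) (h3.sub h4),
    integral_add h1 h2, integral_sub h3 h4]

lemma flux_formula {lam : ℝ} (hl : 0 < lam) (A B : (ℝ × ℝ) × ℝ → ℝ)
    (hA : ContDiff ℝ 1 A) (hsA : HasCompactSupport A)
    (hB : ContDiff ℝ 1 B) (hsB : HasCompactSupport B) :
    Integrable (pFlux lam A B) ∧
    ∫ q in pE lam, (fderiv ℝ A q ((1, 0), 0) + q.1.2 * fderiv ℝ A q (0, 1)
      + (fderiv ℝ B q ((0, 1), 0) - q.1.1 * fderiv ℝ B q (0, 1))) = ∫ z, pFlux lam A B z := by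
  have i1 : Integrable (fun q => fderiv ℝ A q ((1, 0), 0)) :=
    (continuous_fderiv_dir hA _).integrable_of_hasCompactSupport (cs_fderiv_dir hsA _)
  have i2 : Integrable (fun q : (ℝ × ℝ) × ℝ => q.1.2 * fderiv ℝ A q (0, 1)) :=
    (Continuous.mul (by fun_prop) (continuous_fderiv_dir hA _)).integrable_of_hasCompactSupport
      (cs_fderiv_dir hsA _).mul_left
  have i3 : Integrable (fun q => fderiv ℝ B q ((0, 1), 0)) :=
    (continuous_fderiv_dir hB _).integrable_of_hasCompactSupport (cs_fderiv_dir hsB _)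
  have i4 : Integrable (fun q : (ℝ × ℝ) × ℝ => q.1.1 * fderiv ℝ B q (0, 1)) :=
    (Continuous.mul (by fun_prop) (continuous_fderiv_dir hB _)).integrable_of_hasCompactSupport
      (cs_fderiv_dir hsB _).mul_left
  obtain ⟨-, s1⟩ := slicing hl _ i1
  obtain ⟨j2, s2⟩ := slicing hl _ i2
  obtain ⟨-, s3⟩ := slicing hl _ i3
  obtain ⟨j4, s4⟩ := slicing hl _ i4
  rw [slice_formula hl (1, 0) (integral_deriv_fst hl) A hA hsA] at s1
  rw [slice_formula hl (0, 1) (integral_deriv_snd hl) B hB hsB] at s3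
  simp only [vert (fun z => z.2) A hA] at s2 j2
  simp only [vert (fun z => z.1) B hB] at s4 j4
  have j1 := integrable_side hl (1, 0) A hA.continuous hsA
  have j3 := integrable_side hl (0, 1) B hB.continuous hsB
  have e : pFlux lam A B = fun z => -(pL lam z (1, 0) * (A (z, pF lam z) + A (z, -pF lam z)))
      + z.2 * (A (z, pF lam z) - A (z, -pF lam z))
      + (-(pL lam z (0, 1) * (B (z, pF lam z) + B (z, -pF lam z)))
      - z.1 * (B (z, pF lam z) - B (z, -pF lam z))) := by
    funext z
    simp only [pFlux, pL_apply]; ring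
  rw [e]
  refine ⟨(j1.add j2).add (j3.sub j4), ?_⟩
  rw [integral_four _ i1.integrableOn i2.integrableOn i3.integrableOn i4.integrableOn,
    integral_four _ j1 j2 j3 j4, s1, s2, s3, s4]

lemma pair_bound {α β m n N : ℝ} (h : α ^ 2 + β ^ 2 ≤ 1) (hN : 0 ≤ N) (hn : m ^ 2 + n ^ 2 = N ^ 2) :
    |α * m + β * n| ≤ N := by
  refine abs_le_of_sq_le_sq ?_ hN
  have h1 : (α * m + β * n) ^ 2 ≤ (α ^ 2 + β ^ 2) * (m ^ 2 + n ^ 2) := by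
    nlinarith [sq_nonneg (α * n - β * m)]
  rw [hn] at h1
  nlinarith [sq_nonneg N]

lemma flux_bound {lam : ℝ} (hl : 0 < lam) (A B : (ℝ × ℝ) × ℝ → ℝ)
    (h : ∀ q, A q ^ 2 + B q ^ 2 ≤ 1) (z : ℝ × ℝ) :
    |pFlux lam A B z| ≤ 2 * (prho z / pw lam (prho z)) := by
  rcases le_or_gt 1 (lam * prho z) with h1 | h1
  · unfold pFlux
    rw [pF_zero h1, pG_zero h1, pw_zero h1]; simp
  · have hp := pw_pos hl (prho_nonneg z) h1
    have hs := pw_sq hl (prho_nonneg z) h1.le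
    have hN : 0 ≤ prho z / pw lam (prho z) := div_nonneg (prho_nonneg z) hp.le
    have key : (pG lam z ^ 2 + 1) * (z.1 ^ 2 + z.2 ^ 2) = (prho z / pw lam (prho z)) ^ 2 := by
      rw [← prho_sq]
      unfold pG
      field_simp
      rw [hs]; ring
    have b1 := pair_bound (h (z, pF lam z)) hN (m := pG lam z * z.1 + z.2) (n := pG lam z * z.2 - z.1)
      (by rw [← key]; ring)
    have b2 := pair_bound (h (z, -pF lam z)) hN (m := pG lam z * z.1 - z.2) (n := pG lam z * z.2 + z.1)
      (by rw [← key]; ring)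
    have := abs_add_le (A (z, pF lam z) * (pG lam z * z.1 + z.2) + B (z, pF lam z) * (pG lam z * z.2 - z.1))
      (A (z, -pF lam z) * (pG lam z * z.1 - z.2) + B (z, -pF lam z) * (pG lam z * z.2 + z.1))
    have e : pFlux lam A B z =
      (A (z, pF lam z) * (pG lam z * z.1 + z.2) + B (z, pF lam z) * (pG lam z * z.2 - z.1)) +
      (A (z, -pF lam z) * (pG lam z * z.1 - z.2) + B (z, -pF lam z) * (pG lam z * z.2 + z.1)) := by
      unfold pFlux; ring
    rw [e]; linarith

lemma hIota_cs {a : Hei 1 → Fin 1 → ℝ} (h : HasCompactSupport a) :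
    HasCompactSupport (fun q => a (hIota q) 0) := by
  have h1 : HasCompactSupport (fun p => a p 0) := h.comp_left (g := fun u : Fin 1 → ℝ => u 0) rfl
  let κ : Hei 1 → (ℝ × ℝ) × ℝ := fun p => ((p.1 0, p.2.1 0), p.2.2)
  have hκ : Continuous κ := by fun_prop
  have h2 : IsCompact (κ '' tsupport (fun p => a p 0)) := IsCompact.image h1 hκ
  apply HasCompactSupport.of_support_subset_isCompact h2
  intro q hq
  exact ⟨hIota q, subset_tsupport _ hq, rfl⟩

lemma perimeter_integral {lam : ℝ} (hl : 0 < lam) (a b : Hei 1 → Fin 1 → ℝ)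
    (h : IsAdmissible univ a b) :
    ∫ p in pansuBall 1 lam, hDivergence a b p
      = ∫ z, pFlux lam (fun q => a (hIota q) 0) (fun q => b (hIota q) 0) z := by
  obtain ⟨ha, hb, ca, cb, -, -, -⟩ := h
  have ha' : ContDiff ℝ 1 (fun p => a p 0) := contDiff_pi.1 ha 0
  have hb' : ContDiff ℝ 1 (fun p => b p 0) := contDiff_pi.1 hb 0
  rw [← (flux_formula hl (fun q => a (hIota q) 0) (fun q => b (hIota q) 0)
    (ha'.comp hIota.contDiff) (hIota_cs ca) (hb'.comp hIota.contDiff) (hIota_cs cb)).2]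
  rw [← hIota_mp.setIntegral_preimage_emb hIota_emb, preimage_ball]
  have fd : ∀ f : Hei 1 → ℝ, ContDiff ℝ 1 f → ∀ q w,
      fderiv ℝ (fun q => f (hIota q)) q w = fderiv ℝ f (hIota q) (hIota w) := by
    intro f hf q w
    have := ((hf.differentiable (by norm_num)) (hIota q)).hasFDerivAt.comp q hIota.hasFDerivAt
    have e := this.fderiv
    change fderiv ℝ (fun q => f (hIota q)) q = _ at e
    rw [e]; rfl
  have e1 : hIota ((1, 0), 0) = (Pi.single 0 1, 0, 0) := by
    rw [hIota_apply]
    refine Prod.ext ?_ (Prod.ext ?_ rfl)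
    · funext i; rw [Subsingleton.elim i 0]; simp
    · rfl
  have e2 : hIota ((0, 1), 0) = (0, Pi.single 0 1, 0) := by
    rw [hIota_apply]
    refine Prod.ext rfl (Prod.ext ?_ rfl)
    · funext i; rw [Subsingleton.elim i 0]; simp
  have e3 : hIota (0, 1) = (0, 0, 1) := rfl
  congr 1
  funext q
  rw [fd _ ha', fd _ ha', fd _ hb', fd _ hb', e1, e2, e3]
  simp only [hDivergence, Xder, Yder, Finset.univ_unique, Fin.default_eq_zero, Finset.sum_singleton]
  rfl

lemma perimeter_le {lam : ℝ} (hl : 0 < lam) :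
    hPerimeter (pansuBall 1 lam) univ ≤ ENNReal.ofReal (π ^ 2 / lam ^ 3) := by
  apply iSup_le
  rintro ⟨⟨a, b⟩, h⟩
  apply ENNReal.ofReal_le_ofReal
  simp only
  rw [perimeter_integral hl a b h]
  obtain ⟨ha, hb, ca, cb, -, -, hn⟩ := h
  have ha' : ContDiff ℝ 1 (fun p => a p 0) := contDiff_pi.1 ha 0
  have hb' : ContDiff ℝ 1 (fun p => b p 0) := contDiff_pi.1 hb 0
  have hi := (flux_formula hl (fun q => a (hIota q) 0) (fun q => b (hIota q) 0)
    (ha'.comp hIota.contDiff) (hIota_cs ca) (hb'.comp hIota.contDiff) (hIota_cs cb)).1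
  have := integral_mono hi ((integrable_normal hl).const_mul 2) (fun z =>
    (le_abs_self _).trans (flux_bound hl _ _ (fun q => by simpa using hn (hIota q)) z))
  rw [integral_const_mul, integral_normal hl] at this
  refine this.trans (le_of_eq ?_)
  field_simp

/-- Horizontal cutoff. -/
def pEta (lam k : ℝ) (z : ℝ × ℝ) : ℝ :=
  Real.smoothTransition (k * ((z.1 ^ 2 + z.2 ^ 2) * (1 - lam ^ 2 * (z.1 ^ 2 + z.2 ^ 2))) - 1)

/-- Vertical cutoff. -/
def pTh (k t : ℝ) : ℝ := Real.smoothTransition (k - t ^ 2)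

/-- Smooth odd approximation of the sign. -/
def pChi (k t : ℝ) : ℝ := Real.smoothTransition (k * t) - Real.smoothTransition (-(k * t))

/-- Angular weight. -/
def pPsi (lam : ℝ) (z : ℝ × ℝ) : ℝ :=
  √(1 - lam ^ 2 * (z.1 ^ 2 + z.2 ^ 2)) / √(z.1 ^ 2 + z.2 ^ 2)

/-- First component of the test field. -/
def pA (lam k : ℝ) (q : (ℝ × ℝ) × ℝ) : ℝ :=
  pTh k q.2 * (pEta lam k q.1 * (lam * q.1.1) + pChi k q.2 * (pEta lam k q.1 * pPsi lam q.1) * q.1.2)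

/-- Second component of the test field. -/
def pB (lam k : ℝ) (q : (ℝ × ℝ) × ℝ) : ℝ :=
  pTh k q.2 * (pEta lam k q.1 * (lam * q.1.2) - pChi k q.2 * (pEta lam k q.1 * pPsi lam q.1) * q.1.1)

lemma contDiff_sT : ContDiff ℝ 1 Real.smoothTransition := Real.smoothTransition.contDiff (n := 1)

lemma contDiff_pEta (lam k : ℝ) : ContDiff ℝ 1 (pEta lam k) := by
  unfold pEta
  exact contDiff_sT.comp (by fun_prop)

lemma contDiff_pTh (k : ℝ) : ContDiff ℝ 1 (pTh k) := by
  unfold pTh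
  exact contDiff_sT.comp (by fun_prop)

lemma contDiff_pChi (k : ℝ) : ContDiff ℝ 1 (pChi k) := by
  unfold pChi
  exact (contDiff_sT.comp (by fun_prop)).sub (contDiff_sT.comp (by fun_prop))

lemma contDiff_pEtaPsi (lam : ℝ) {k : ℝ} (hk : 0 ≤ k) : ContDiff ℝ 1 (fun z => pEta lam k z * pPsi lam z) := by
  rw [contDiff_iff_contDiffAt]
  intro z
  by_cases h : 0 < (z.1 ^ 2 + z.2 ^ 2) * (1 - lam ^ 2 * (z.1 ^ 2 + z.2 ^ 2))
  · have h1 : 0 < z.1 ^ 2 + z.2 ^ 2 := by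
      rcases (by positivity : 0 ≤ z.1 ^ 2 + z.2 ^ 2).lt_or_eq with h' | h'
      · exact h'
      · rw [← h'] at h; simp at h
    have h2 : 0 < 1 - lam ^ 2 * (z.1 ^ 2 + z.2 ^ 2) := pos_of_mul_pos_right h h1.le
    apply (contDiff_pEta lam k).contDiffAt.mul
    unfold pPsi
    refine ContDiffAt.div (ContDiffAt.sqrt (by fun_prop) h2.ne') (ContDiffAt.sqrt (by fun_prop) h1.ne') ?_
    exact (Real.sqrt_pos.2 h1).ne'
  · have : (fun z => pEta lam k z * pPsi lam z) =ᶠ[𝓝 z] fun _ => 0 := by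
      have hc : Continuous (fun z : ℝ × ℝ =>
          k * ((z.1 ^ 2 + z.2 ^ 2) * (1 - lam ^ 2 * (z.1 ^ 2 + z.2 ^ 2))) - 1) := by fun_prop
      · have hz : k * ((z.1 ^ 2 + z.2 ^ 2) * (1 - lam ^ 2 * (z.1 ^ 2 + z.2 ^ 2))) - 1 < 0 := by
          have := mul_nonpos_of_nonneg_of_nonpos hk (not_lt.1 h)
          linarith
        filter_upwards [hc.continuousAt.eventually (gt_mem_nhds hz)] with y hy
        unfold pEta
        rw [Real.smoothTransition.zero_of_nonpos hy.le, zero_mul]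
    exact contDiffAt_const.congr_of_eventuallyEq this

lemma contDiff_pA (lam : ℝ) {k : ℝ} (hk : 0 ≤ k) : ContDiff ℝ 1 (pA lam k) := by
  unfold pA
  have h1 := (contDiff_pTh k).comp (contDiff_snd (E := ℝ × ℝ) (F := ℝ))
  have h2 := (contDiff_pChi k).comp (contDiff_snd (E := ℝ × ℝ) (F := ℝ))
  have h3 := (contDiff_pEta lam k).comp (contDiff_fst (E := ℝ × ℝ) (F := ℝ))
  have h4 := (contDiff_pEtaPsi lam hk).comp (contDiff_fst (E := ℝ × ℝ) (F := ℝ))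
  exact h1.mul ((h3.mul (by fun_prop)).add ((h2.mul h4).mul (by fun_prop)))

lemma contDiff_pB (lam : ℝ) {k : ℝ} (hk : 0 ≤ k) : ContDiff ℝ 1 (pB lam k) := by
  unfold pB
  have h1 := (contDiff_pTh k).comp (contDiff_snd (E := ℝ × ℝ) (F := ℝ))
  have h2 := (contDiff_pChi k).comp (contDiff_snd (E := ℝ × ℝ) (F := ℝ))
  have h3 := (contDiff_pEta lam k).comp (contDiff_fst (E := ℝ × ℝ) (F := ℝ))
  have h4 := (contDiff_pEtaPsi lam hk).comp (contDiff_fst (E := ℝ × ℝ) (F := ℝ))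
  exact h1.mul ((h3.mul (by fun_prop)).sub ((h2.mul h4).mul (by fun_prop)))

lemma pEta_pos {lam k : ℝ} (hk : 0 ≤ k) {z : ℝ × ℝ} (h : pEta lam k z ≠ 0) :
    0 < z.1 ^ 2 + z.2 ^ 2 ∧ 0 < 1 - lam ^ 2 * (z.1 ^ 2 + z.2 ^ 2) := by
  have h0 : 0 < (z.1 ^ 2 + z.2 ^ 2) * (1 - lam ^ 2 * (z.1 ^ 2 + z.2 ^ 2)) := by
    by_contra h'
    apply h
    apply Real.smoothTransition.zero_of_nonpos
    have := mul_nonpos_of_nonneg_of_nonpos hk (not_lt.1 h')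
    linarith
  have h1 : 0 < z.1 ^ 2 + z.2 ^ 2 := by
    rcases (by positivity : 0 ≤ z.1 ^ 2 + z.2 ^ 2).lt_or_eq with h' | h'
    · exact h'
    · rw [← h'] at h0; simp at h0
  exact ⟨h1, pos_of_mul_pos_right h0 h1.le⟩

lemma sT_sq (x : ℝ) : Real.smoothTransition x ^ 2 ≤ 1 := by
  have h1 := Real.smoothTransition.nonneg x
  have h2 := Real.smoothTransition.le_one x
  nlinarith

lemma pChi_sq (k t : ℝ) : pChi k t ^ 2 ≤ 1 := by
  unfold pChi
  have h1 := Real.smoothTransition.nonneg (k * t)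
  have h2 := Real.smoothTransition.le_one (k * t)
  have h3 := Real.smoothTransition.nonneg (-(k * t))
  have h4 := Real.smoothTransition.le_one (-(k * t))
  rw [sq_le_one_iff_abs_le_one, abs_le]
  constructor <;> linarith

lemma pAB_norm {lam k : ℝ} (hk : 0 ≤ k) (q : (ℝ × ℝ) × ℝ) : pA lam k q ^ 2 + pB lam k q ^ 2 ≤ 1 := by
  by_cases h : pEta lam k q.1 = 0
  · simp [pA, pB, h]
  · obtain ⟨h1, h2⟩ := pEta_pos hk h
    have hp : pPsi lam q.1 ^ 2 * (q.1.1 ^ 2 + q.1.2 ^ 2) = 1 - lam ^ 2 * (q.1.1 ^ 2 + q.1.2 ^ 2) := by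
      unfold pPsi
      rw [div_pow, Real.sq_sqrt h1.le, Real.sq_sqrt h2.le, div_mul_cancel₀ _ h1.ne']
    have e : pA lam k q ^ 2 + pB lam k q ^ 2 = (pTh k q.2 ^ 2 * pEta lam k q.1 ^ 2) *
        (lam ^ 2 * (q.1.1 ^ 2 + q.1.2 ^ 2) + pChi k q.2 ^ 2 *
          (pPsi lam q.1 ^ 2 * (q.1.1 ^ 2 + q.1.2 ^ 2))) := by
      unfold pA pB; ring
    rw [e, hp]
    have a1 : pTh k q.2 ^ 2 ≤ 1 := sT_sq _
    have a2 : pEta lam k q.1 ^ 2 ≤ 1 := sT_sq _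
    have a3 := pChi_sq k q.2
    apply mul_le_one₀ (mul_le_one₀ a1 (sq_nonneg _) a2)
    · positivity
    · nlinarith

lemma pAB_support {lam k : ℝ} (hl : 0 < lam) (hk : 0 ≤ k) (q : (ℝ × ℝ) × ℝ)
    (h : pTh k q.2 ≠ 0 ∧ pEta lam k q.1 ≠ 0) :
    q ∈ Metric.closedBall (0 : (ℝ × ℝ) × ℝ) (1 / lam + k + 1) := by
  obtain ⟨h1, h2⟩ := pEta_pos hk h.2
  rw [mem_closedBall_zero_iff, Prod.norm_def]
  have hlp : 0 < 1 / lam := by positivity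
  apply max_le
  · refine (abs_le_prho _).trans ?_
    have : prho q.1 ≤ 1 / lam := by
      rw [← prho_sq] at h2
      rw [le_div_iff₀ hl]
      have := prho_nonneg q.1
      nlinarith
    linarith
  · have : 0 < k - q.2 ^ 2 := by
      by_contra h'
      exact h.1 (Real.smoothTransition.zero_of_nonpos (not_lt.1 h'))
    rw [Real.norm_eq_abs]
    have := abs_nonneg q.2
    have := sq_abs q.2
    nlinarith

/-- Coordinates in the other direction. -/
def hKappa (p : Hei 1) : (ℝ × ℝ) × ℝ := ((p.1 0, p.2.1 0), p.2.2)

lemma hIota_hKappa (p : Hei 1) : hIota (hKappa p) = p := by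
  rw [hIota_apply]
  refine Prod.ext ?_ (Prod.ext ?_ rfl)
  · funext i; rw [Subsingleton.elim i 0]; rfl
  · funext i; rw [Subsingleton.elim i 0]; rfl

lemma contDiff_hKappa : ContDiff ℝ 1 hKappa := by
  unfold hKappa
  fun_prop

lemma cs_field {M : ℝ} (f : (ℝ × ℝ) × ℝ → ℝ)
    (h : ∀ q, f q ≠ 0 → q ∈ Metric.closedBall (0 : (ℝ × ℝ) × ℝ) M) :
    HasCompactSupport (fun (p : Hei 1) (_ : Fin 1) => f (hKappa p)) := by
  have hc : IsCompact (hIota '' Metric.closedBall (0 : (ℝ × ℝ) × ℝ) M) :=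
    (isCompact_closedBall _ _).image hIota.continuous
  apply HasCompactSupport.of_support_subset_isCompact hc
  intro p hp
  refine ⟨hKappa p, h _ ?_, hIota_hKappa p⟩
  intro h0
  apply hp
  funext i
  exact h0

lemma admissible_field {lam k : ℝ} (hl : 0 < lam) (hk : 0 ≤ k) :
    IsAdmissible (n := 1) univ (fun p _ => pA lam k (hKappa p)) (fun p _ => pB lam k (hKappa p)) := by
  refine ⟨contDiff_pi.2 fun _ => (contDiff_pA lam hk).comp contDiff_hKappa,
    contDiff_pi.2 fun _ => (contDiff_pB lam hk).comp contDiff_hKappa,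
    cs_field _ fun q hq => pAB_support hl hk q ?_, cs_field _ fun q hq => pAB_support hl hk q ?_,
    subset_univ _, subset_univ _, fun p => ?_⟩
  · constructor
    · intro h; apply hq; simp [pA, h]
    · intro h; apply hq; simp [pA, h]
  · constructor
    · intro h; apply hq; simp [pB, h]
    · intro h; apply hq; simp [pB, h]
  · simpa using pAB_norm hk (hKappa p)

lemma eventually_one (u : ℕ → ℝ) (h : Tendsto u atTop atTop) :
    ∀ᶠ k in atTop, Real.smoothTransition (u k) = 1 := by
  filter_upwards [h.eventually_ge_atTop 1] with k hk
  exact Real.smoothTransition.one_of_one_le hk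

lemma pFlux_field_tendsto {lam : ℝ} (hl : 0 < lam) (z : ℝ × ℝ) :
    Tendsto (fun k : ℕ => pFlux lam (pA lam k) (pB lam k) z) atTop
      (𝓝 (2 * (prho z / pw lam (prho z)))) := by
  apply tendsto_const_nhds.congr'
  rcases le_or_gt 1 (lam * prho z) with h1 | h1
  · refine Eventually.of_forall fun k => ?_
    unfold pFlux
    rw [pF_zero h1, pG_zero h1, pw_zero h1]; simp
  rcases (prho_nonneg z).eq_or_lt with h0 | h0
  · refine Eventually.of_forall fun k => ?_
    have hs := prho_sq z
    rw [← h0] at hs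
    have hx : z.1 = 0 := by nlinarith [sq_nonneg z.1, sq_nonneg z.2]
    have hy : z.2 = 0 := by nlinarith [sq_nonneg z.1, sq_nonneg z.2]
    unfold pFlux
    rw [hx, hy, ← h0]; simp
  have hp := pw_pos hl h0.le h1
  have hs := pw_sq hl h0.le h1.le
  have hF : 0 < pF lam z := profile_pos hl h0.le h1
  have tk : Tendsto (fun k : ℕ => (k : ℝ)) atTop atTop := tendsto_natCast_atTop_atTop
  have hc : 0 < (z.1 ^ 2 + z.2 ^ 2) * (1 - lam ^ 2 * (z.1 ^ 2 + z.2 ^ 2)) := by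
    rw [← prho_sq, ← hs]; positivity
  have e1 := eventually_one _ (tendsto_atTop_add_const_right _ (-1) (tk.atTop_mul_const hc))
  have e2 := eventually_one _ (tendsto_atTop_add_const_right _ (-(pF lam z ^ 2)) tk)
  have e3 := eventually_one _ (tk.atTop_mul_const hF)
  filter_upwards [e1, e2, e3] with k h1 h2 h3
  have r1 : pEta lam k z = 1 := h1
  have r2 : pTh k (pF lam z) = 1 := h2
  have r2' : pTh k (-pF lam z) = 1 := by unfold pTh; rw [neg_sq]; exact h2
  have hz : Real.smoothTransition (-((k : ℝ) * pF lam z)) = 0 :=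
    Real.smoothTransition.zero_of_nonpos (by have := hF.le; simp; positivity)
  have r3 : pChi k (pF lam z) = 1 := by unfold pChi; rw [hz, h3, sub_zero]
  have r3' : pChi k (-pF lam z) = -1 := by
    unfold pChi; rw [mul_neg, neg_neg, hz, h3, zero_sub]
  have r4 : pPsi lam z = pw lam (prho z) / prho z := by
    unfold pPsi pw; rw [prho_sq]; rfl
  simp only [pFlux, pA, pB, r1, r2, r2', r3, r3', r4]
  have : prho z / pw lam (prho z) = (z.1 ^ 2 + z.2 ^ 2) * (pG lam z * lam + pw lam (prho z) / prho z) := by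
    rw [← prho_sq]
    unfold pG
    field_simp
    rw [hs]; ring
  rw [this]; ring

lemma le_perimeter {lam : ℝ} (hl : 0 < lam) :
    ENNReal.ofReal (π ^ 2 / lam ^ 3) ≤ hPerimeter (pansuBall 1 lam) univ := by
  have key : Tendsto (fun k : ℕ => ∫ z, pFlux lam (pA lam k) (pB lam k) z) atTop
      (𝓝 (∫ z, 2 * (prho z / pw lam (prho z)))) := by
    apply tendsto_integral_of_dominated_convergence (fun z => 2 * (prho z / pw lam (prho z)))
    · intro k
      have hk : (0 : ℝ) ≤ k := k.cast_nonneg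
      have had := admissible_field hl hk
      exact (flux_formula hl _ _ (contDiff_pA lam hk) (hIota_cs had.2.2.1)
        (contDiff_pB lam hk) (hIota_cs had.2.2.2.1)).1.1
    · exact (integrable_normal hl).const_mul 2
    · intro k
      exact Eventually.of_forall fun z => flux_bound hl _ _ (pAB_norm k.cast_nonneg) z
    · exact Eventually.of_forall (pFlux_field_tendsto hl)
  rw [integral_const_mul, integral_normal hl] at key
  have e : 2 * (π ^ 2 / (2 * lam ^ 3)) = π ^ 2 / lam ^ 3 := by field_simp
  rw [e] at key
  refine le_of_tendsto ((ENNReal.continuous_ofReal.tendsto _).comp key)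
    (Eventually.of_forall fun k => ?_)
  have had := admissible_field hl (k.cast_nonneg : (0 : ℝ) ≤ k)
  have := perimeter_integral hl _ _ had
  have h2 : ∫ z, pFlux lam (pA lam k) (pB lam k) z = _ := this.symm
  simp only [Function.comp]
  rw [h2]
  exact le_iSup (fun ab : {ab : (Hei 1 → Fin 1 → ℝ) × (Hei 1 → Fin 1 → ℝ) //
    IsAdmissible univ ab.1 ab.2} => ENNReal.ofReal (∫ p in pansuBall 1 lam,
      hDivergence ab.1.1 ab.1.2 p)) ⟨(_, _), had⟩

/-- In the first Heisenberg group `ℍ¹`, the Pansu ball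
satisfies `P(B_λ) = π²/λ³` and `|B_λ| = 3π²/(8λ⁴)`, so the scale-invariant
isoperimetric ratio is `P(B_λ)⁴/|B_λ|³ = 512π²/27` for every `λ > 0`. -/
theorem pansuBall_values_in_H1 (lam : ℝ) (hlam : 0 < lam) :
    hPerimeter (pansuBall 1 lam) Set.univ = ENNReal.ofReal (π ^ 2 / lam ^ 3) ∧
    volume (pansuBall 1 lam) = ENNReal.ofReal (3 * π ^ 2 / (8 * lam ^ 4)) ∧
    (hPerimeter (pansuBall 1 lam) Set.univ).toReal ^ 4
        / (volume (pansuBall 1 lam)).toReal ^ 3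
      = 512 * π ^ 2 / 27 := by
  have hP := le_antisymm (perimeter_le hlam) (le_perimeter hlam)
  have hV := volume_ball hlam
  refine ⟨hP, hV, ?_⟩
  rw [hP, hV, ENNReal.toReal_ofReal (by positivity), ENNReal.toReal_ofReal (by positivity)]
  field_simp
  norm_num

end
end
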